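/- For any negative field F^t of the algorithm TC with corresponding changeset X_t, it is possible to legally shift its requests up so that they remain within the slots of F^t and, after the modification, each node of X_t is requested exactly α times within F^t. -/

import Mathlib

open scoped Classical

/-!
Common setup for the online tree caching problem
(Bienkowski, Marcinkowski, Pacut, Schmid, Spyra, "Online Tree Caching").
-/

/-- A finite rooted tree on the vertex type `V`: every vertex has a parent,
the root is its own parent, and iterating `parent` from any vertex reaches the root. -/
structure RTree (V : Type) where
  root : V
  parent : V → V
  parent_root : parent root = root
  reaches_root : ∀ v : V, ∃ n : ℕ, parent^[n] v = root

namespace RTree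

variable {V : Type}

/-- The subtree `T(u)`: `u` together with all its descendants. -/
def subtree (T : RTree V) (u : V) : Set V :=
  {v | ∃ n : ℕ, T.parent^[n] v = u}

/-- `C` is a subforest of `T`: with every node it contains the whole subtree below it. -/
def Subforest (T : RTree V) (C : Set V) : Prop :=
  ∀ v ∈ C, T.subtree v ⊆ C

/-- `A` is a tree cap rooted at `v`: `A ⊆ T(v)`, `v ∈ A`, and `A` is closed under
taking the parent (towards `v`). -/
def TreeCap (T : RTree V) (v : V) (A : Set V) : Prop :=
  A ⊆ T.subtree v ∧ v ∈ A ∧ ∀ u ∈ A, u ≠ v → T.parent u ∈ A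

/-- `X` is a valid positive changeset for the cache `C`. -/
def ValidPos (T : RTree V) (C X : Set V) : Prop :=
  X.Nonempty ∧ X ∩ C = ∅ ∧ T.Subforest (C ∪ X)

/-- `X` is a valid negative changeset for the cache `C`. -/
def ValidNeg (T : RTree V) (C X : Set V) : Prop :=
  X.Nonempty ∧ X ⊆ C ∧ T.Subforest (C \ X)

/-- `X` is a valid changeset for the cache `C`. -/
def Valid (T : RTree V) (C X : Set V) : Prop :=
  T.ValidPos C X ∨ T.ValidNeg C X

/-- `w` is the root of a tree (connected component) of the subforest `C`. -/
def IsCompRoot (T : RTree V) (C : Set V) (w : V) : Prop :=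
  w ∈ C ∧ (w = T.root ∨ T.parent w ∉ C)

/-- The depth of a node: its distance to the root. -/
noncomputable def depth [DecidableEq V] (T : RTree V) (v : V) : ℕ :=
  Nat.find (T.reaches_root v)

/-- The height `h(T)` of the tree: its number of levels. -/
noncomputable def height [Fintype V] [DecidableEq V] (T : RTree V) : ℕ :=
  (Finset.univ.sup fun v => T.depth v) + 1

end RTree

/-- A request: a node together with a sign (`true` = positive, `false` = negative). -/
abbrev Request (V : Type) := V × Bool

/-- The request `r` incurs cost `1` when the cache is `C`
(a positive request to a non-cached node, or a negative request to a cached node). -/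
def Costly {V : Type} (r : Request V) (C : Set V) : Prop :=
  (r.2 = true ∧ r.1 ∉ C) ∨ (r.2 = false ∧ r.1 ∈ C)

/-- The sum of the counters `f` over the set of nodes `A`. -/
noncomputable def cntSum {V : Type} [Fintype V] (f : V → ℕ) (A : Set V) : ℕ :=
  ∑ v : V, A.indicator f v

/-- The number of nodes of a changeset (`0` for no changeset). -/
noncomputable def chgSize {V : Type} : Option (Set V) → ℕ
  | none => 0
  | some X => X.ncard

/-- One phase of the algorithm `TC` on the request sequence `req` (the request of
round `t ≥ 1` is `req t`), starting at time `0` with an empty cache.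
`cache t` is the cache contents during round `t`; `cnt t` are the counter values just
after serving the request of round `t` (used for the decision at time `t`);
`chg t` is the changeset applied at time `t` (right after round `t`), if any. -/
structure TCPhase {V : Type} [Fintype V] [DecidableEq V]
    (T : RTree V) (α : ℕ) (req : ℕ → Request V) where
  cache : ℕ → Set V
  cnt : ℕ → V → ℕ
  chg : ℕ → Option (Set V)
  cache_subforest : ∀ t, T.Subforest (cache t)
  cache_zero : cache 0 = ∅
  cnt_zero : ∀ v, cnt 0 v = 0
  cnt_rec : ∀ t v, cnt (t + 1) v =
    (if ∃ X, chg t = some X ∧ v ∈ X then 0 else cnt t v)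
    + (if (req (t + 1)).1 = v ∧ Costly (req (t + 1)) (cache (t + 1)) then 1 else 0)
  step_some : ∀ t X, chg t = some X →
    T.Valid (cache t) X ∧
    X.ncard * α ≤ cntSum (cnt t) X ∧
    (∀ Y, T.Valid (cache t) Y → X ⊂ Y → cntSum (cnt t) Y < Y.ncard * α) ∧
    cache (t + 1) = if T.ValidPos (cache t) X then cache t ∪ X else cache t \ X
  step_none : ∀ t, chg t = none →
    cache (t + 1) = cache t ∧
    ∀ X, T.Valid (cache t) X → cntSum (cnt t) X < X.ncard * α

namespace TCPhase

variable {V : Type} [Fintype V] [DecidableEq V]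
  {T : RTree V} {α : ℕ} {req : ℕ → Request V}

/-- The counter values at time `t`, right after the cache change at time `t`
(counters of fetched/evicted nodes are reset to `0`). -/
noncomputable def cntPost (E : TCPhase T α req) (t : ℕ) (v : V) : ℕ :=
  if ∃ X, E.chg t = some X ∧ v ∈ X then 0 else E.cnt t v

/-- `last_v(t)`: the last time strictly before `t` at which `v` changed its
cached/non-cached state (`0`, the beginning of the phase, if there is none). -/
noncomputable def lastChg (E : TCPhase T α req) (v : V) (t : ℕ) : ℕ :=
  ((Finset.range t).filter fun s => ¬ ((v ∈ E.cache s) ↔ v ∈ E.cache (s + 1))).sup id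

/-- The slot `(v, r)` belongs to the field `F^t`. -/
def inField (E : TCPhase T α req) (t : ℕ) (v : V) (r : ℕ) : Prop :=
  ∃ X, E.chg t = some X ∧ v ∈ X ∧ E.lastChg v t < r ∧ r ≤ t

/-- The number of requests of the sequence `ρ` lying in slots of `F^t_{≤ τ} ∩ D`. -/
noncomputable def fieldReqIn (E : TCPhase T α req) (ρ : ℕ → Request V)
    (t : ℕ) (D : Set V) (τ : ℕ) : ℕ :=
  ((Finset.Icc 1 t).filter fun r => r ≤ τ ∧ (ρ r).1 ∈ D ∧ E.inField t (ρ r).1 r).card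

/-- `req(F^t)`: the number of requests of `ρ` in slots of the field `F^t`. -/
noncomputable def fieldReq (E : TCPhase T α req) (ρ : ℕ → Request V) (t : ℕ) : ℕ :=
  E.fieldReqIn ρ t Set.univ t

/-- `size(F^t_{≤ τ} ∩ D)`: the number of distinct nodes having a slot in `F^t_{≤ τ} ∩ D`. -/
noncomputable def fieldSizeIn (E : TCPhase T α req) (t : ℕ) (D : Set V) (τ : ℕ) : ℕ :=
  (Finset.univ.filter fun v : V => v ∈ D ∧ ∃ r, r ≤ τ ∧ E.inField t v r).card

/-- The standing assumption: no positive requests are given to cached nodes and no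
negative requests to non-cached ones (so every request incurs cost `1` for `TC`). -/
def GoodReq (E : TCPhase T α req) : Prop :=
  ∀ t, 1 ≤ t →
    ((req t).2 = true → (req t).1 ∉ E.cache t) ∧
    ((req t).2 = false → (req t).1 ∈ E.cache t)

/-- The phase consists of rounds `1, …, tEnd`: no cache of `TC` before time `tEnd`
exceeds the capacity `kONL` (at time `tEnd` the triggered fetch, if any, is performed
even if it exceeds the capacity, and is followed by the final eviction). -/
def PhaseEnd (E : TCPhase T α req) (kONL tEnd : ℕ) : Prop :=
  ∀ t, t < tEnd → (E.cache (t + 1)).ncard ≤ kONL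

/-- `k_P`: the number of nodes in `TC`'s cache at the end of the phase
(after the fetch at time `tEnd`, before the final eviction). -/
noncomputable def kP (E : TCPhase T α req) (tEnd : ℕ) : ℕ :=
  (E.cache (tEnd + 1)).ncard

/-- The phase ending at `tEnd` is finished: the fetch at time `tEnd` exceeded the
capacity `kONL`. -/
def FinishedAt (E : TCPhase T α req) (kONL tEnd : ℕ) : Prop :=
  E.PhaseEnd kONL tEnd ∧ kONL < E.kP tEnd

/-- `size(𝓕)`: the total size of all fields of the phase. -/
noncomputable def sizeFields (E : TCPhase T α req) (tEnd : ℕ) : ℕ :=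
  ∑ t ∈ Finset.Icc 1 tEnd, chgSize (E.chg t)

/-- `req(F^∞)`: the number of requests of the phase lying in slots of the open field
(slots covered by no field of the phase). -/
noncomputable def openReq (E : TCPhase T α req) (tEnd : ℕ) : ℕ :=
  ((Finset.Icc 1 tEnd).filter fun r => ∀ t, t ≤ tEnd → ¬ E.inField t (req r).1 r).card

/-- `TC(P)`: the total cost paid by `TC` during the phase: serving the requests,
fetching/evicting the applied changesets (`α` per node), and the final eviction
(`α · k_P`) if the phase is finished. -/
noncomputable def tcCost (E : TCPhase T α req) (kONL tEnd : ℕ) : ℕ :=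
  ((Finset.Icc 1 tEnd).filter fun r => Costly (req r) (E.cache r)).card
  + α * E.sizeFields tEnd
  + (if kONL < E.kP tEnd then α * E.kP tEnd else 0)

/-- The tree cap `Y` (rooted at `u`, inside the negative field `F^t`) is proper for
the request sequence `ρ`: it holds `req(F^t ∩ Y) = |Y| · α`, and `F^t_{≤ τ} ∩ D` is
not over-requested for every tree cap `D ⊆ Y` rooted at `u` and every time `τ ≤ t`. -/
def Proper (E : TCPhase T α req) (ρ : ℕ → Request V) (t : ℕ) (u : V) (Y : Set V) : Prop :=
  E.fieldReqIn ρ t Y t = Y.ncard * α ∧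
  ∀ (D : Set V) (τ : ℕ), T.TreeCap u D → D ⊆ Y → τ ≤ t →
    E.fieldReqIn ρ t D τ ≤ E.fieldSizeIn t D τ * α

end TCPhase

/-- `D` is a feasible cache schedule for an (offline) algorithm with cache size `k`:
at every time the cache is a subforest of `T` of at most `k` nodes. -/
def IsSchedule {V : Type} (T : RTree V) (k : ℕ) (D : ℕ → Set V) : Prop :=
  ∀ t, T.Subforest (D t) ∧ (D t).ncard ≤ k

/-- The cost of serving the requests of rounds `a, …, b` of `ρ` when the cache during
round `r` is `D r`. -/
noncomputable def serveCost {V : Type} (ρ : ℕ → Request V) (D : ℕ → Set V) (a b : ℕ) : ℕ :=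
  ((Finset.Icc a b).filter fun r => Costly (ρ r) (D r)).card

/-- The reorganization cost of the schedule `D` (`α` per fetched or evicted node) over
the times `a, …, b - 1` (the change at time `t` leads from `D t` to `D (t+1)`). -/
noncomputable def moveCost {V : Type} (α : ℕ) (D : ℕ → Set V) (a b : ℕ) : ℕ :=
  α * ∑ t ∈ Finset.Ico a b, ((D (t + 1) \ D t).ncard + (D t \ D (t + 1)).ncard)

/-- `OPT`: the minimum cost of serving rounds `a, …, b` of `ρ` by an offline algorithm
with cache size `k` that may start with an arbitrary cache. -/
noncomputable def optCostFrom {V : Type} (T : RTree V) (α k : ℕ)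
    (ρ : ℕ → Request V) (a b : ℕ) : ℕ :=
  sInf {n | ∃ D : ℕ → Set V, IsSchedule T k D ∧
    n = serveCost ρ D a b + moveCost α D a b}

/-- `OPT`: the minimum cost of serving rounds `1, …, b` of `ρ` by an offline algorithm
with cache size `k` that starts with the empty cache. -/
noncomputable def optCostEmpty {V : Type} (T : RTree V) (α k : ℕ)
    (ρ : ℕ → Request V) (b : ℕ) : ℕ :=
  sInf {n | ∃ D : ℕ → Set V, IsSchedule T k D ∧ D 0 = ∅ ∧
    n = serveCost ρ D 1 b + moveCost α D 0 b}

/-- `ρ'` is obtained from `ρ` by legally shifting requests: signs are preserved, every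
positive request is moved to a descendant of its node (or kept), and every negative
request is moved to an ancestor of its node (or kept). -/
def LegalShift {V : Type} (T : RTree V) (ρ ρ' : ℕ → Request V) : Prop :=
  ∀ t, (ρ' t).2 = (ρ t).2 ∧
    ((ρ t).2 = true → (ρ' t).1 ∈ T.subtree (ρ t).1) ∧
    ((ρ t).2 = false → (ρ t).1 ∈ T.subtree (ρ' t).1)

/-- A full run of the algorithm `TC` with cache capacity `kONL` on the request
sequence `req`, including phase restarts: whenever the fetch of a saturated changeset
would exceed the capacity, `TC` instead evicts its whole cache and a new phase starts
(`newPhase t` holds, and all counters are reset). -/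
structure TCRun {V : Type} [Fintype V] [DecidableEq V]
    (T : RTree V) (α kONL : ℕ) (req : ℕ → Request V) where
  cache : ℕ → Set V
  cnt : ℕ → V → ℕ
  chg : ℕ → Option (Set V)
  newPhase : ℕ → Prop
  cache_subforest : ∀ t, T.Subforest (cache t)
  cache_zero : cache 0 = ∅
  cnt_zero : ∀ v, cnt 0 v = 0
  capacity : ∀ t, (cache t).ncard ≤ kONL
  cnt_rec : ∀ t v, cnt (t + 1) v =
    (if newPhase t ∨ ∃ X, chg t = some X ∧ v ∈ X then 0 else cnt t v)
    + (if (req (t + 1)).1 = v ∧ Costly (req (t + 1)) (cache (t + 1)) then 1 else 0)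
  step_some : ∀ t X, chg t = some X →
    T.Valid (cache t) X ∧
    X.ncard * α ≤ cntSum (cnt t) X ∧
    (∀ Y, T.Valid (cache t) Y → X ⊂ Y → cntSum (cnt t) Y < Y.ncard * α) ∧
    ((T.ValidPos (cache t) X ∧ (cache t ∪ X).ncard ≤ kONL ∧
        cache (t + 1) = cache t ∪ X ∧ ¬ newPhase t) ∨
     (T.ValidPos (cache t) X ∧ kONL < (cache t ∪ X).ncard ∧
        cache (t + 1) = ∅ ∧ newPhase t) ∨
     (T.ValidNeg (cache t) X ∧ cache (t + 1) = cache t \ X ∧ ¬ newPhase t))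
  step_none : ∀ t, chg t = none →
    cache (t + 1) = cache t ∧ ¬ newPhase t ∧
    ∀ X, T.Valid (cache t) X → cntSum (cnt t) X < X.ncard * α

/-- `TC(I)`: the total cost paid by the run `E` of `TC` on the rounds `1, …, N`:
serving the requests, plus `α` per fetched/evicted node (on a phase restart the whole
cache is evicted). -/
noncomputable def TCRun.cost {V : Type} [Fintype V] [DecidableEq V]
    {T : RTree V} {α kONL : ℕ} {req : ℕ → Request V}
    (E : TCRun T α kONL req) (N : ℕ) : ℕ :=
  ((Finset.Icc 1 N).filter fun r => Costly (req r) (E.cache r)).card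
  + α * ∑ t ∈ Finset.Icc 1 N,
      (if E.newPhase t then (E.cache t).ncard else chgSize (E.chg t))

namespace RTree

variable {V : Type} {T : RTree V}

theorem mem_subtree_self (v : V) : v ∈ T.subtree v := ⟨0, rfl⟩

theorem subtree_trans {u v w : V} (hvu : v ∈ T.subtree u) (huw : u ∈ T.subtree w) :
    v ∈ T.subtree w := by
  obtain ⟨n, rfl⟩ := hvu
  obtain ⟨m, rfl⟩ := huw
  exact ⟨m + n, Function.iterate_add_apply _ _ _ _⟩

theorem subtree_total {u v w : V} (hu : v ∈ T.subtree u) (hw : v ∈ T.subtree w) :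
    u ∈ T.subtree w ∨ w ∈ T.subtree u := by
  obtain ⟨n, rfl⟩ := hu
  obtain ⟨m, rfl⟩ := hw
  rcases le_total n m with h | h
  · exact Or.inl ⟨m - n, by rw [← Function.iterate_add_apply, Nat.sub_add_cancel h]⟩
  · exact Or.inr ⟨n - m, by rw [← Function.iterate_add_apply, Nat.sub_add_cancel h]⟩

theorem Subforest.union {C D : Set V} (hC : T.Subforest C) (hD : T.Subforest D) :
    T.Subforest (C ∪ D) := by
  rintro v (hv | hv)
  · exact (hC v hv).trans Set.subset_union_left
  · exact (hD v hv).trans Set.subset_union_right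

theorem Subforest.inter {C D : Set V} (hC : T.Subforest C) (hD : T.Subforest D) :
    T.Subforest (C ∩ D) :=
  fun v hv => Set.subset_inter (hC v hv.1) (hD v hv.2)

theorem ValidPos.not_validNeg {C X : Set V} (h : T.ValidPos C X) : ¬ T.ValidNeg C X := by
  rintro ⟨⟨v, hv⟩, hX, -⟩
  exact Set.notMem_empty v (h.2.1 ▸ ⟨hv, hX hv⟩)

theorem ValidNeg.mem_of_mem_subtree {C X : Set V} (h : T.ValidNeg C X) {u v : V}
    (hv : v ∈ X) (hu : u ∈ C) (hvu : v ∈ T.subtree u) : u ∈ X := by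
  by_contra hX
  exact (h.2.2 u ⟨hu, hX⟩ hvu).2 hv

end RTree

section cntSum

variable {V : Type} [Fintype V]

theorem cntSum_eq_sum_filter (f : V → ℕ) (A : Set V) :
    cntSum f A = ∑ v with v ∈ A, f v := by
  rw [cntSum, Finset.sum_filter]
  exact Finset.sum_congr rfl fun v _ => Set.indicator_apply _ _ _

theorem ncard_mul_eq_cntSum (A : Set V) (α : ℕ) : A.ncard * α = cntSum (fun _ => α) A := by
  rw [cntSum_eq_sum_filter, Finset.sum_const, smul_eq_mul, Set.ncard_eq_toFinset_card']
  congr 2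
  ext v
  simp

theorem cntSum_union (f : V → ℕ) {A B : Set V} (h : Disjoint A B) :
    cntSum f (A ∪ B) = cntSum f A + cntSum f B := by
  simp only [cntSum, Set.indicator_union_of_disjoint h, Finset.sum_add_distrib]

theorem cntSum_le_cntSum {f g : V → ℕ} {A : Set V} (h : ∀ v ∈ A, f v ≤ g v) :
    cntSum f A ≤ cntSum g A := by
  simp only [cntSum_eq_sum_filter]
  exact Finset.sum_le_sum fun v hv => h v (Finset.mem_filter.1 hv).2

theorem cntSum_congr {f g : V → ℕ} {A : Set V} (h : ∀ v ∈ A, f v = g v) :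
    cntSum f A = cntSum g A :=
  le_antisymm (cntSum_le_cntSum fun v hv => (h v hv).le)
    (cntSum_le_cntSum fun v hv => (h v hv).ge)

theorem cntSum_eq_zero {f : V → ℕ} {A : Set V} (h : ∀ v ∈ A, f v = 0) : cntSum f A = 0 := by
  rw [cntSum_eq_sum_filter]
  exact Finset.sum_eq_zero fun v hv => h v (Finset.mem_filter.1 hv).2

theorem cntSum_diff_add (f : V → ℕ) (A B : Set V) :
    cntSum f (A \ B) + cntSum f (A ∩ B) = cntSum f A := by
  rw [← cntSum_union f (Set.disjoint_sdiff_inter), Set.sdiff_union_inter]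

theorem ncard_mul_pos {A : Set V} (hA : A.Nonempty) {α : ℕ} (hα : 1 ≤ α) : 0 < A.ncard * α :=
  Nat.mul_pos ((Set.ncard_pos (Set.toFinite A)).2 hA) hα

end cntSum

namespace TCPhase

variable {V : Type} [Fintype V] [DecidableEq V]
  {T : RTree V} {α : ℕ} {req : ℕ → Request V}

theorem cache_succ_of_validPos (E : TCPhase T α req) {t : ℕ} {X : Set V}
    (hX : E.chg t = some X) (h : T.ValidPos (E.cache t) X) :
    E.cache (t + 1) = E.cache t ∪ X := by
  rw [(E.step_some t X hX).2.2.2, if_pos h]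

theorem cache_succ_of_validNeg (E : TCPhase T α req) {t : ℕ} {X : Set V}
    (hX : E.chg t = some X) (h : T.ValidNeg (E.cache t) X) :
    E.cache (t + 1) = E.cache t \ X := by
  rw [(E.step_some t X hX).2.2.2, if_neg fun h' => h'.not_validNeg h]

theorem exists_chg_iff (E : TCPhase T α req) (t : ℕ) (v : V) :
    (∃ X, E.chg t = some X ∧ v ∈ X) ↔ ¬ (v ∈ E.cache t ↔ v ∈ E.cache (t + 1)) := by
  cases hX : E.chg t with
  | none => simp [(E.step_none t hX).1]
  | some X =>
    rcases (E.step_some t X hX).1 with h | h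
    · have h1 : v ∈ X → v ∉ E.cache t := fun h1 h2 =>
        Set.notMem_empty v (h.2.1 ▸ ⟨h1, h2⟩)
      simp only [Option.some.injEq, exists_eq_left', E.cache_succ_of_validPos hX h, Set.mem_union]
      tauto
    · have h1 : v ∈ X → v ∈ E.cache t := fun h1 => h.2.1 h1
      simp only [Option.some.injEq, exists_eq_left', E.cache_succ_of_validNeg hX h, Set.mem_sdiff]
      tauto

theorem cntPost_of_mem (E : TCPhase T α req) {t : ℕ} {X : Set V} (hX : E.chg t = some X)
    {v : V} (hv : v ∈ X) : E.cntPost t v = 0 :=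
  if_pos ⟨X, hX, hv⟩

theorem cntPost_of_notMem (E : TCPhase T α req) {t : ℕ} {X : Set V} (hX : E.chg t = some X)
    {v : V} (hv : v ∉ X) : E.cntPost t v = E.cnt t v := by
  refine if_neg ?_
  rintro ⟨Y, hY, hvY⟩
  rw [hX, Option.some.injEq] at hY
  exact hv (hY ▸ hvY)

theorem cntSum_cnt_succ_le (E : TCPhase T α req) (t : ℕ) (A : Set V) :
    cntSum (E.cnt (t + 1)) A ≤ cntSum (E.cntPost t) A + 1 := by
  calc cntSum (E.cnt (t + 1)) A
      ≤ ∑ v with v ∈ A, (E.cntPost t v + if (req (t + 1)).1 = v then 1 else 0) := by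
        rw [cntSum_eq_sum_filter]
        refine Finset.sum_le_sum fun v _ => ?_
        rw [E.cnt_rec]
        refine Nat.add_le_add_left ?_ _
        split_ifs <;> simp_all
    _ ≤ cntSum (E.cntPost t) A + 1 := by
        rw [Finset.sum_add_distrib, cntSum_eq_sum_filter, Finset.sum_ite_eq]
        split_ifs <;> simp

theorem cntSum_cnt_succ_of_notMem (E : TCPhase T α req) (t : ℕ) {A : Set V}
    (h : (req (t + 1)).1 ∉ A) : cntSum (E.cnt (t + 1)) A = cntSum (E.cntPost t) A := by
  refine cntSum_congr fun v hv => ?_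
  have hne : (req (t + 1)).1 ≠ v := fun h' => h (h' ▸ hv)
  simp [E.cnt_rec, cntPost, hne]

/-- Two disjoint changesets cannot become saturated by the same request. -/
theorem cntSum_cnt_lt_of_disjoint (E : TCPhase T α req) (hα : 1 ≤ α) {t : ℕ}
    (hprev : ∀ s, s + 1 = t → ∀ Y, T.Valid (E.cache t) Y →
      cntSum (E.cntPost s) Y < Y.ncard * α)
    {X Z : Set V} (hX : T.Valid (E.cache t) X) (hZ : T.Valid (E.cache t) Z)
    (hXZ : Disjoint X Z) (hsat : X.ncard * α ≤ cntSum (E.cnt t) X) :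
    cntSum (E.cnt t) Z < Z.ncard * α := by
  cases t with
  | zero =>
    rw [cntSum_eq_zero fun v _ => E.cnt_zero v]
    exact ncard_mul_pos (hZ.elim (·.1) (·.1)) hα
  | succ s =>
    have hreq : (req (s + 1)).1 ∈ X := by
      by_contra h
      rw [E.cntSum_cnt_succ_of_notMem s h] at hsat
      exact (hprev s rfl X hX).not_ge hsat
    rw [E.cntSum_cnt_succ_of_notMem s (Set.disjoint_left.1 hXZ hreq)]
    exact hprev s rfl Z hZ

/-- Right after the decision at time `t`, no valid changeset is saturated. -/
theorem cntSum_cntPost_lt (E : TCPhase T α req) (hα : 1 ≤ α) (t : ℕ) :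
    ∀ Y, T.Valid (E.cache (t + 1)) Y → cntSum (E.cntPost t) Y < Y.ncard * α := by
  induction t using Nat.strong_induction_on with
  | _ t ih =>
  intro Y hY
  have hYne : Y.Nonempty := hY.elim (·.1) (·.1)
  cases hX : E.chg t with
  | none =>
    obtain ⟨hc, hlt⟩ := E.step_none t hX
    have hcnt (v : V) : E.cntPost t v = E.cnt t v := if_neg (by simp [hX])
    rw [cntSum_congr fun v _ => hcnt v]
    exact hlt Y (hc ▸ hY)
  | some X =>
    obtain ⟨hval, hsat, hmax, -⟩ := E.step_some t X hX
    have extend (hd : Disjoint X Y) (hu : T.Valid (E.cache t) (X ∪ Y)) :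
        cntSum (E.cntPost t) Y < Y.ncard * α := by
      have hss : X ⊂ X ∪ Y := by
        refine Set.ssubset_iff_subset_ne.2 ⟨Set.subset_union_left, fun h => ?_⟩
        obtain ⟨v, hv⟩ := hYne
        exact Set.disjoint_left.1 hd (h ▸ Or.inr hv) hv
      have h := hmax _ hu hss
      rw [cntSum_congr (g := E.cnt t) fun v hv =>
        E.cntPost_of_notMem hX (Set.disjoint_right.1 hd hv)]
      rw [cntSum_union _ hd, ncard_mul_eq_cntSum, cntSum_union _ hd, ← ncard_mul_eq_cntSum,
        ← ncard_mul_eq_cntSum] at h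
      omega
    have remainder (hv : (Y \ X).Nonempty → T.Valid (E.cache t) (Y \ X)) :
        cntSum (E.cntPost t) Y < Y.ncard * α := by
      rw [← cntSum_diff_add _ Y X,
        cntSum_eq_zero fun v (hv : v ∈ Y ∩ X) => E.cntPost_of_mem hX hv.2, add_zero,
        cntSum_congr (g := E.cnt t) fun v (hv : v ∈ Y \ X) => E.cntPost_of_notMem hX hv.2]
      rcases (Y \ X).eq_empty_or_nonempty with h | h
      · rw [h, cntSum_eq_zero (by simp)]
        exact ncard_mul_pos hYne hα
      · refine (E.cntSum_cnt_lt_of_disjoint hα ?_ hval (hv h) Set.disjoint_sdiff_right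
          hsat).trans_le (Nat.mul_le_mul_right _ (Set.ncard_le_ncard Set.sdiff_subset))
        rintro s rfl
        exact ih s (Nat.lt_succ_self s)
    rcases hval with hp | hn
    · rw [E.cache_succ_of_validPos hX hp] at hY
      rcases hY with ⟨-, hY1, hY2⟩ | ⟨-, hY1, hY2⟩
      · rw [← Set.disjoint_iff_inter_eq_empty, Set.disjoint_union_right] at hY1
        refine extend hY1.2.symm (Or.inl ⟨hp.1.inl, ?_, ?_⟩)
        · rw [Set.union_inter_distrib_right, hp.2.1, hY1.1.inter_eq, Set.empty_union]
        · rwa [← Set.union_assoc]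
      · refine remainder fun h => Or.inr ⟨h, fun v hv => (hY1 hv.1).resolve_right hv.2, ?_⟩
        have h' := (E.cache_subforest t).inter hY2
        have hd : ∀ v ∈ X, v ∉ E.cache t := fun v h1 h2 =>
          Set.notMem_empty v (hp.2.1 ▸ ⟨h1, h2⟩)
        convert h' using 1
        ext v
        have := hd v
        simp only [Set.mem_sdiff, Set.mem_inter_iff, Set.mem_union]
        tauto
    · rw [E.cache_succ_of_validNeg hX hn] at hY
      rcases hY with ⟨-, hY1, hY2⟩ | ⟨-, hY1, hY2⟩
      · have hd : ∀ v ∈ Y, v ∈ E.cache t → v ∈ X := fun v h1 h2 => by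
          by_contra h3
          exact Set.notMem_empty v (hY1 ▸ ⟨h1, h2, h3⟩)
        refine remainder fun h => Or.inl ⟨h, ?_, ?_⟩
        · exact Set.eq_empty_iff_forall_notMem.2 fun v hv => hv.1.2 (hd v hv.1.1 hv.2)
        · convert (E.cache_subforest t).union hY2 using 1
          ext v
          have := @hn.2.1 v
          simp only [Set.mem_sdiff, Set.mem_union]
          tauto
      · refine extend (Set.disjoint_right.2 fun v hv => (hY1 hv).2) (Or.inr ⟨hn.1.inl, ?_, ?_⟩)
        · exact Set.union_subset hn.2.1 (hY1.trans Set.sdiff_subset)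
        · rwa [← Set.sdiff_sdiff]

theorem cntSum_cnt_le (E : TCPhase T α req) (hα : 1 ≤ α) {t : ℕ} {Y : Set V}
    (hY : T.Valid (E.cache t) Y) : cntSum (E.cnt t) Y ≤ Y.ncard * α := by
  cases t with
  | zero => simp [cntSum_eq_zero fun v _ => E.cnt_zero v]
  | succ s => exact (E.cntSum_cnt_succ_le s Y).trans (E.cntSum_cntPost_lt hα s Y hY)

theorem lastChg_le (E : TCPhase T α req) (v : V) (t : ℕ) : E.lastChg v t ≤ t :=
  Finset.sup_le fun _ hs => (Finset.mem_range.1 (Finset.mem_filter.1 hs).1).le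

theorem mem_cache_of_lastChg_lt (E : TCPhase T α req) {v : V} {t r : ℕ} (hv : v ∈ E.cache t)
    (hr : E.lastChg v t < r) (hrt : r ≤ t) : v ∈ E.cache r := by
  induction hrt using Nat.decreasingInduction with
  | self => exact hv
  | of_succ s hs ih =>
    by_contra hvs
    have hmem : s ∈ (Finset.range t).filter
        fun s => ¬ ((v ∈ E.cache s) ↔ v ∈ E.cache (s + 1)) :=
      Finset.mem_filter.2 ⟨Finset.mem_range.2 hs, by simp [hvs, ih (by omega)]⟩
    exact hr.not_ge (Finset.le_sup (f := id) hmem)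

theorem notMem_cache_lastChg (E : TCPhase T α req) {v : V} {t : ℕ} (hv : v ∈ E.cache t) :
    v ∉ E.cache (E.lastChg v t) := by
  set S := (Finset.range t).filter fun s => ¬ ((v ∈ E.cache s) ↔ v ∈ E.cache (s + 1)) with hS
  rcases S.eq_empty_or_nonempty with h | h
  · have h0 : E.lastChg v t = 0 := by
      rw [lastChg, ← hS, h]
      rfl
    rw [h0, E.cache_zero]
    exact Set.notMem_empty v
  · obtain ⟨s, hs, heq⟩ := S.exists_mem_eq_sup h id
    replace heq : E.lastChg v t = s := heq
    obtain ⟨hst, hne⟩ := Finset.mem_filter.1 hs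
    have := E.mem_cache_of_lastChg_lt (r := s + 1) hv (by omega) (Finset.mem_range.1 hst)
    rw [heq]
    tauto

theorem lastChg_lt_of_forall_mem (E : TCPhase T α req) {v : V} {t r : ℕ} (hrt : r ≤ t)
    (h : ∀ s, r ≤ s → s ≤ t → v ∈ E.cache s) : E.lastChg v t < r := by
  by_contra! hr
  exact E.notMem_cache_lastChg (h t hrt le_rfl) (h _ hr (E.lastChg_le v t))

theorem lastChg_lt (E : TCPhase T α req) {v : V} {t : ℕ} (hv : v ∈ E.cache t) :
    E.lastChg v t < t :=
  E.lastChg_lt_of_forall_mem le_rfl fun _ h1 h2 => (le_antisymm h2 h1) ▸ hv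

theorem lastChg_mono (E : TCPhase T α req) {u v : V} {t : ℕ} (hu : u ∈ E.cache t)
    (hvu : v ∈ T.subtree u) : E.lastChg v t ≤ E.lastChg u t := by
  refine Nat.lt_succ_iff.1 (E.lastChg_lt_of_forall_mem (E.lastChg_lt hu) fun s h1 h2 => ?_)
  exact E.cache_subforest s u (E.mem_cache_of_lastChg_lt hu h1 h2) hvu

/-- While a node stays cached, its counter is the number of requests to it since its fetch. -/
theorem cnt_eq_card (E : TCPhase T α req) (hgood : E.GoodReq) {v : V} {t τ : ℕ}
    (hv : v ∈ E.cache t) (hτ : E.lastChg v t < τ) (hτt : τ ≤ t) :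
    E.cnt τ v = ((Finset.Ioc (E.lastChg v t) τ).filter fun r => (req r).1 = v).card := by
  have costly (s : ℕ) (hs : v ∈ E.cache (s + 1)) :
      ((req (s + 1)).1 = v ∧ Costly (req (s + 1)) (E.cache (s + 1))) ↔ (req (s + 1)).1 = v := by
    refine and_iff_left_of_imp fun h => Or.inr ⟨?_, h ▸ hs⟩
    have := (hgood (s + 1) (by omega)).1
    rw [h] at this
    cases hb : (req (s + 1)).2 <;> tauto
  induction τ, Nat.succ_le_of_lt hτ using Nat.le_induction with
  | base =>
    have h1 := E.notMem_cache_lastChg hv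
    have h2 := E.mem_cache_of_lastChg_lt hv hτ hτt
    simp only [Nat.succ_eq_add_one] at h2 ⊢
    rw [E.cnt_rec, if_pos ((E.exists_chg_iff _ _).2 (by tauto)), Nat.Ioc_succ_singleton,
      Finset.filter_singleton]
    simp only [costly _ h2]
    split_ifs <;> simp
  | succ s hs ih =>
    have h1 := E.mem_cache_of_lastChg_lt hv hs (by omega)
    have h2 := E.mem_cache_of_lastChg_lt hv hτ hτt
    rw [E.cnt_rec, if_neg (mt (E.exists_chg_iff _ _).1 (by tauto)), ih hs (by omega),
      ← Finset.insert_Ioc_right_eq_Ioc_add_one (by omega), Finset.filter_insert]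
    simp only [costly _ h2]
    split_ifs
    · rw [Finset.card_insert_of_notMem (by simp)]
    · rfl

theorem cnt_le_cnt_succ (E : TCPhase T α req) {v : V} {s : ℕ} (h1 : v ∈ E.cache s)
    (h2 : v ∈ E.cache (s + 1)) : E.cnt s v ≤ E.cnt (s + 1) v := by
  rw [E.cnt_rec, if_neg (mt (E.exists_chg_iff _ _).1 (by tauto))]
  exact Nat.le_add_right _ _

/-- At every time `τ ≤ t`, a set of nodes of the negative field `F^t` already present at time
`τ` that is upward closed among all such nodes is not over-requested. -/
theorem cntSum_cnt_le_of_upward_closed (E : TCPhase T α req) (hα : 1 ≤ α)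
    {t : ℕ} {X : Set V} (hneg : T.ValidNeg (E.cache t) X) {τ : ℕ} (hτ : τ ≤ t) :
    ∀ A ⊆ X, (∀ v ∈ A, E.lastChg v t < τ) →
      (∀ v ∈ A, ∀ u ∈ X, E.lastChg u t < τ → v ∈ T.subtree u → u ∈ A) →
      cntSum (E.cnt τ) A ≤ A.ncard * α := by
  have of_valid (τ : ℕ) (A : Set V) (hA : A ⊆ E.cache τ)
      (hup : ∀ v ∈ A, ∀ u ∈ E.cache τ, v ∈ T.subtree u → u ∈ A) :
      cntSum (E.cnt τ) A ≤ A.ncard * α := by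
    rcases A.eq_empty_or_nonempty with rfl | hne
    · simp [cntSum_eq_zero]
    · exact E.cntSum_cnt_le hα (Or.inr ⟨hne, hA, fun u hu v hv =>
        ⟨E.cache_subforest τ u hu.1 hv, fun hvA => hu.2 (hup v hvA u hu.1 hv)⟩⟩)
  induction hτ using Nat.decreasingInduction with
  | self =>
    intro A hAX _ hup
    refine of_valid t A (hAX.trans hneg.2.1) fun v hv u hu hvu => ?_
    exact hup v hv u (hneg.mem_of_mem_subtree (hAX hv) hu hvu) (E.lastChg_lt hu) hvu
  | of_succ τ hτ ih =>
    intro A hAX hAτ hup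
    have hAc : A ⊆ E.cache τ := fun v hv =>
      E.mem_cache_of_lastChg_lt (hneg.2.1 (hAX hv)) (hAτ v hv) hτ.le
    -- Nodes below a currently cached node that is not yet part of the field.
    set B : Set V := {v | ∃ z ∈ E.cache τ, v ∈ T.subtree z ∧ ¬ (z ∈ X ∧ E.lastChg z t < τ)}
    have hdiff : cntSum (E.cnt τ) (A \ B) ≤ (A \ B).ncard * α := by
      refine of_valid τ _ (Set.sdiff_subset.trans hAc) fun v hv u hu hvu => ?_
      have hu' : u ∈ X ∧ E.lastChg u t < τ := by
        by_contra h
        exact hv.2 ⟨u, hu, hvu, h⟩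
      refine ⟨hup v hv.1 u hu'.1 hu'.2 hvu, ?_⟩
      rintro ⟨z, hz, huz, hz'⟩
      exact hv.2 ⟨z, hz, RTree.subtree_trans hvu huz, hz'⟩
    have hinter : cntSum (E.cnt τ) (A ∩ B) ≤ (A ∩ B).ncard * α := by
      refine (cntSum_le_cntSum fun v hv => E.cnt_le_cnt_succ (hAc hv.1) ?_).trans
        (ih (A ∩ B) (Set.inter_subset_left.trans hAX)
          (fun v hv => (hAτ v hv.1).trans (Nat.lt_succ_self τ)) ?_)
      · exact E.mem_cache_of_lastChg_lt (hneg.2.1 (hAX hv.1))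
          ((hAτ v hv.1).trans (Nat.lt_succ_self τ)) hτ
      · rintro v ⟨hvA, z, hz, hvz, hz'⟩ u hu huτ hvu
        have huz : u ∈ T.subtree z := by
          refine (RTree.subtree_total hvu hvz).resolve_right fun hzu => hz' ?_
          have hzt : z ∈ E.cache t := E.cache_subforest t u (hneg.2.1 hu) hzu
          refine ⟨hneg.mem_of_mem_subtree (hAX hvA) hzt hvz, ?_⟩
          refine lt_of_le_of_ne ((E.lastChg_mono (hneg.2.1 hu) hzu).trans
            (Nat.lt_succ_iff.1 huτ)) fun h => ?_
          exact E.notMem_cache_lastChg hzt (h ▸ hz)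
        have huc : u ∈ E.cache τ := E.cache_subforest τ z hz huz
        have huτ' : E.lastChg u t < τ := by
          refine lt_of_le_of_ne (Nat.lt_succ_iff.1 huτ) fun h => ?_
          exact E.notMem_cache_lastChg (hneg.2.1 hu) (h ▸ huc)
        exact ⟨hup v hvA u hu huτ' hvu, z, hz, huz, hz'⟩
    have h1 := cntSum_diff_add (E.cnt τ) A B
    have h2 := cntSum_diff_add (fun _ : V => α) A B
    simp only [← ncard_mul_eq_cntSum] at h2
    omega

/-- Hall's condition: requests of the negative field `F^t` that can be shifted up
only to nodes of `D` number at most `|D| · α`. -/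
theorem card_le_ncard_mul (E : TCPhase T α req) (hα : 1 ≤ α) (hgood : E.GoodReq)
    {t : ℕ} {X : Set V} (hneg : T.ValidNeg (E.cache t) X) (D : Set V) (J : Finset ℕ)
    (hJt : ∀ r ∈ J, r ≤ t) (hJX : ∀ r ∈ J, (req r).1 ∈ X)
    (hJL : ∀ r ∈ J, E.lastChg (req r).1 t < r)
    (hJD : ∀ r ∈ J, ∀ u ∈ X, (req r).1 ∈ T.subtree u → E.lastChg u t < r → u ∈ D) :
    J.card ≤ D.ncard * α := by
  let P (v : V) (r : ℕ) : Prop :=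
    v ∈ X ∧ E.lastChg v t < r ∧ ∀ u ∈ X, v ∈ T.subtree u → E.lastChg u t < r → u ∈ D
  let e (v : V) : ℕ := Nat.findGreatest (P v) t
  let S : Finset V := Finset.univ.filter fun v => ∃ r ≤ t, P v r
  have hJP : ∀ r ∈ J, P (req r).1 r := fun r hr => ⟨hJX r hr, hJL r hr, hJD r hr⟩
  have he : ∀ v ∈ S, P v (e v) := fun v hv => by
    obtain ⟨r, hrt, hr⟩ := (Finset.mem_filter.1 hv).2
    exact Nat.findGreatest_spec hrt hr
  have het (v : V) : e v ≤ t := Nat.findGreatest_le t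
  have hfiber : ∀ v ∈ S, (J.filter fun r => (req r).1 = v).card ≤ E.cnt (e v) v := by
    intro v hv
    rw [E.cnt_eq_card hgood (hneg.2.1 (he v hv).1) (he v hv).2.1 (het v)]
    refine Finset.card_le_card fun r hr => ?_
    obtain ⟨hrJ, rfl⟩ := Finset.mem_filter.1 hr
    exact Finset.mem_filter.2 ⟨Finset.mem_Ioc.2
      ⟨hJL r hrJ, Nat.le_findGreatest (hJt r hrJ) (hJP r hrJ)⟩, rfl⟩
  have hlevel (τ : ℕ) (hτ : τ ≤ t) :
      ∑ v ∈ S with e v = τ, E.cnt (e v) v ≤ ∑ v ∈ S with e v = τ, α := by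
    obtain ⟨B, hB⟩ : ∃ B : Set V, ∀ v, v ∈ B ↔ v ∈ S ∧ e v = τ :=
      ⟨{v | v ∈ S ∧ e v = τ}, fun _ => Iff.rfl⟩
    have h := E.cntSum_cnt_le_of_upward_closed hα hneg hτ B
      (fun v hv => (he v ((hB v).1 hv).1).1)
      (fun v hv => ((hB v).1 hv).2 ▸ (he v ((hB v).1 hv).1).2.1) ?_
    · rw [ncard_mul_eq_cntSum, cntSum_eq_sum_filter, cntSum_eq_sum_filter] at h
      have hset : (Finset.univ.filter fun v => v ∈ B) =
          S.filter fun v => e v = τ := by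
        ext v
        simp [hB]
      rw [hset] at h
      refine le_trans (le_of_eq (Finset.sum_congr rfl fun v hv => ?_)) h
      rw [(Finset.mem_filter.1 hv).2]
    · intro v hv w hw hwL hvw
      obtain ⟨hvS, rfl⟩ := (hB v).1 hv
      have hPw : P w (e v) := ⟨hw, hwL, fun u hu hwu huL =>
        (he v hvS).2.2 u hu (RTree.subtree_trans hvw hwu) huL⟩
      have hwS : w ∈ S := Finset.mem_filter.2 ⟨Finset.mem_univ w, _, het v, hPw⟩
      refine (hB w).2 ⟨hwS, le_antisymm ?_ (Nat.le_findGreatest (het v) hPw)⟩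
      by_contra! hlt
      -- `w` is usable later than `v`, so `v` is blocked by a node strictly below `w`.
      have hnP : ¬ P v (e w) := Nat.findGreatest_is_greatest hlt (het w)
      refine hnP ⟨(he v hvS).1, (he v hvS).2.1.trans hlt, fun u hu hvu huL => ?_⟩
      rcases RTree.subtree_total hvu hvw with huw | hwu
      · exact (he v hvS).2.2 u hu hvu
          ((E.lastChg_mono (hneg.2.1 hw) huw).trans_lt hwL)
      · exact (he w hwS).2.2 u hu hwu huL
  calc J.card = ∑ v ∈ S, (J.filter fun r => (req r).1 = v).card :=
        Finset.card_eq_sum_card_fiberwise fun r hr =>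
          Finset.mem_filter.2 ⟨Finset.mem_univ _, r, hJt r hr, hJP r hr⟩
    _ ≤ ∑ v ∈ S, E.cnt (e v) v := Finset.sum_le_sum hfiber
    _ = ∑ τ ∈ Finset.range (t + 1), ∑ v ∈ S with e v = τ, E.cnt (e v) v :=
        (Finset.sum_fiberwise_of_maps_to
          (fun v _ => Finset.mem_range.2 (Nat.lt_succ_of_le (het v))) _).symm
    _ ≤ ∑ τ ∈ Finset.range (t + 1), ∑ v ∈ S with e v = τ, α :=
        Finset.sum_le_sum fun τ hτ => hlevel τ (Nat.lt_succ_iff.1 (Finset.mem_range.1 hτ))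
    _ = ∑ v ∈ S, α :=
        Finset.sum_fiberwise_of_maps_to
          (fun v _ => Finset.mem_range.2 (Nat.lt_succ_of_le (het v))) _
    _ ≤ D.ncard * α := by
        rw [Finset.sum_const, smul_eq_mul]
        refine Nat.mul_le_mul_right _ ?_
        rw [← Set.ncard_coe_finset]
        refine Set.ncard_le_ncard fun v hv => ?_
        exact (he v hv).2.2 v (he v hv).1 (RTree.mem_subtree_self v) (he v hv).2.1

theorem inField_iff (E : TCPhase T α req) {t : ℕ} {X : Set V} (hchg : E.chg t = some X)
    {v : V} {r : ℕ} : E.inField t v r ↔ v ∈ X ∧ E.lastChg v t < r ∧ r ≤ t := by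
  simp [inField, hchg]

/-- The rounds whose requests lie in slots of the field `F^t`. -/
noncomputable def fieldRounds (E : TCPhase T α req) (t : ℕ) : Finset ℕ :=
  (Finset.Icc 1 t).filter fun r => E.inField t (req r).1 r

theorem mem_fieldRounds (E : TCPhase T α req) {t r : ℕ} :
    r ∈ E.fieldRounds t ↔ E.inField t (req r).1 r := by
  refine ⟨fun h => (Finset.mem_filter.1 h).2, fun h => Finset.mem_filter.2 ⟨?_, h⟩⟩
  obtain ⟨X, -, -, h1, h2⟩ := h
  exact Finset.mem_Icc.2 ⟨by omega, h2⟩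

theorem card_fieldRounds (E : TCPhase T α req) (hgood : E.GoodReq) {t : ℕ} {X : Set V}
    (hchg : E.chg t = some X) (hX : X ⊆ E.cache t) :
    (E.fieldRounds t).card = cntSum (E.cnt t) X := by
  rw [cntSum_eq_sum_filter, Finset.card_eq_sum_card_fiberwise (f := fun r => (req r).1)
    (t := Finset.univ.filter (· ∈ X))]
  · refine Finset.sum_congr rfl fun v hv => ?_
    have hv' := (Finset.mem_filter.1 hv).2
    rw [E.cnt_eq_card hgood (hX hv') (E.lastChg_lt (hX hv')) le_rfl]
    congr 1
    ext r
    simp only [Finset.mem_filter, mem_fieldRounds, E.inField_iff hchg, Finset.mem_Ioc]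
    constructor
    · rintro ⟨h, rfl⟩
      exact ⟨h.2, rfl⟩
    · rintro ⟨h, rfl⟩
      exact ⟨⟨hv', h⟩, rfl⟩
  · intro r hr
    have h := (E.inField_iff hchg).1 (E.mem_fieldRounds.1 hr)
    simpa using h.1

/-- The requests of a negative field can be assigned to slots above them in the field so
that every node of the changeset is assigned exactly `α` of them. -/
theorem exists_assignment (E : TCPhase T α req) (hα : 1 ≤ α) (hgood : E.GoodReq)
    {t : ℕ} {X : Set V} (hchg : E.chg t = some X) (hneg : T.ValidNeg (E.cache t) X) :
    ∃ g : ℕ → V,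
      (∀ r ∈ E.fieldRounds t, (req r).1 ∈ T.subtree (g r) ∧ E.inField t (g r) r) ∧
      ∀ v ∈ X, ((E.fieldRounds t).filter fun r => g r = v).card = α := by
  let N (r : E.fieldRounds t) : Finset (V × Fin α) :=
    (Finset.univ.filter fun u => (req r).1 ∈ T.subtree u ∧ E.inField t u r) ×ˢ Finset.univ
  have hall (s : Finset (E.fieldRounds t)) : s.card ≤ (s.biUnion N).card := by
    let D : Finset V := Finset.univ.filter
      fun u => ∃ r ∈ s, (req r).1 ∈ T.subtree u ∧ E.inField t u r
    have hN : s.biUnion N = D ×ˢ Finset.univ := by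
      ext p
      simp [N, D]
    have hin : ∀ r ∈ s.map (Function.Embedding.subtype _),
        (req r).1 ∈ X ∧ E.lastChg (req r).1 t < r ∧ r ≤ t := fun r hr => by
      obtain ⟨r, -, rfl⟩ := Finset.mem_map.1 hr
      exact (E.inField_iff hchg).1 (E.mem_fieldRounds.1 r.2)
    have h := E.card_le_ncard_mul hα hgood hneg D (s.map (Function.Embedding.subtype _))
      (fun r hr => (hin r hr).2.2) (fun r hr => (hin r hr).1) (fun r hr => (hin r hr).2.1) ?_
    · rw [hN, Finset.card_product, Finset.card_fin]
      rwa [Finset.card_map, Set.ncard_coe_finset] at h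
    · intro r hr u hu hru huL
      have hrt := (hin r hr).2.2
      obtain ⟨r, hrs, rfl⟩ := Finset.mem_map.1 hr
      exact Finset.mem_coe.2 (Finset.mem_filter.2 ⟨Finset.mem_univ u, r, hrs, hru,
        (E.inField_iff hchg).2 ⟨hu, huL, hrt⟩⟩)
  obtain ⟨f, hf, hfN⟩ := (Finset.all_card_le_biUnion_card_iff_exists_injective N).1 hall
  have hfN' (r : E.fieldRounds t) :
      (req r).1 ∈ T.subtree (f r).1 ∧ E.inField t (f r).1 r := by
    simpa [N] using hfN r
  let g (r : ℕ) : V := if h : r ∈ E.fieldRounds t then (f ⟨r, h⟩).1 else (req r).1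
  have hg (r : ℕ) (h : r ∈ E.fieldRounds t) : g r = (f ⟨r, h⟩).1 := dif_pos h
  refine ⟨g, fun r hr => hg r hr ▸ hfN' ⟨r, hr⟩, ?_⟩
  have hle (v : V) : ((E.fieldRounds t).filter fun r => g r = v).card ≤ α := by
    rw [← Finset.card_attach]
    refine (Finset.card_le_card_of_injOn (t := Finset.univ)
      (fun r => (f ⟨r.1, (Finset.mem_filter.1 r.2).1⟩).2) (fun _ _ => Finset.mem_univ _) ?_).trans
      (Finset.card_fin α).le
    intro r _ r' _ h
    have h1 := (Finset.mem_filter.1 r.2).2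
    have h2 := (Finset.mem_filter.1 r'.2).2
    rw [hg _ (Finset.mem_filter.1 r.2).1] at h1
    rw [hg _ (Finset.mem_filter.1 r'.2).1] at h2
    have heq := hf (Prod.ext (h1.trans h2.symm) h)
    exact Subtype.ext (Subtype.mk.inj heq)
  have hsum : ∑ v with v ∈ X, ((E.fieldRounds t).filter fun r => g r = v).card =
      (E.fieldRounds t).card := by
    refine (Finset.card_eq_sum_card_fiberwise fun r hr => ?_).symm
    have h := hfN' ⟨r, hr⟩
    rw [← hg r hr, E.inField_iff hchg] at h
    simpa using h.2.1
  have heq : ∑ v with v ∈ X, ((E.fieldRounds t).filter fun r => g r = v).card =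
      ∑ v with v ∈ X, α := by
    refine le_antisymm (Finset.sum_le_sum fun v _ => hle v) ?_
    rw [hsum, E.card_fieldRounds hgood hchg hneg.2.1, ← cntSum_eq_sum_filter,
      ← ncard_mul_eq_cntSum]
    exact (E.step_some t X hchg).2.1
  intro v hv
  exact (Finset.sum_eq_sum_iff_of_le fun v _ => hle v).1 heq v (by simpa using hv)

end TCPhase

/-- for any negative field `F^t` of `TC`, one can legally shift its
requests up, keeping them within the slots of `F^t`, so that afterwards every node of
the changeset `X_t` is requested exactly `α` times within `F^t`. -/
theorem shift_up_negative_field {V : Type} [Fintype V] [DecidableEq V]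
    {T : RTree V} {α : ℕ} {req : ℕ → Request V}
    (E : TCPhase T α req) (hα : 1 ≤ α) (hgood : E.GoodReq)
    (t : ℕ) (X : Set V) (hchg : E.chg t = some X) (hneg : T.ValidNeg (E.cache t) X) :
    ∃ ρ' : ℕ → Request V,
      (∀ r, (ρ' r).2 = (req r).2) ∧
      (∀ r, ρ' r ≠ req r →
        E.inField t (req r).1 r ∧ (req r).1 ∈ T.subtree (ρ' r).1 ∧
        E.inField t (ρ' r).1 r) ∧
      (∀ v ∈ X, E.fieldReqIn ρ' t {v} t = α) := by
  obtain ⟨g, hg, hcard⟩ := E.exists_assignment hα hgood hchg hneg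
  let ρ (r : ℕ) : Request V := if r ∈ E.fieldRounds t then (g r, (req r).2) else req r
  have hρ (r : ℕ) (h : r ∈ E.fieldRounds t) : ρ r = (g r, (req r).2) := if_pos h
  have hρ' (r : ℕ) (h : r ∉ E.fieldRounds t) : ρ r = req r := if_neg h
  refine ⟨ρ, fun r => ?_, fun r hr => ?_, fun v hv => ?_⟩
  · by_cases h : r ∈ E.fieldRounds t
    · rw [hρ r h]
    · rw [hρ' r h]
  · by_cases h : r ∈ E.fieldRounds t
    · rw [hρ r h]
      exact ⟨E.mem_fieldRounds.1 h, hg r h⟩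
    · exact absurd (hρ' r h) hr
  · refine Eq.trans ?_ (hcard v hv)
    rw [TCPhase.fieldReqIn]
    congr 1
    ext r
    simp only [Finset.mem_filter, Finset.mem_Icc, Set.mem_singleton_iff]
    by_cases h : r ∈ E.fieldRounds t
    · have hrt := Finset.mem_Icc.1 (Finset.mem_filter.1 h).1
      have hfld := (hg r h).2
      rw [hρ r h]
      tauto
    · rw [hρ' r h, ← E.mem_fieldRounds]
      tauto
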